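/- arXiv:1410.0287 — 2 statements merged into one kernel-verified Lean document; each statement's English description precedes it below -/
import Mathlib

section
/- Let V be a real inner product space, let n ≥ 2 be a natural number and let k be a natural number with 1 ≤ k ≤ n - 1. Let p₁, …, p_k ∈ V satisfy ⟪pᵢ, pᵢ⟫ = 1 for all i and ⟪pᵢ, pⱼ⟫ = -1/n for all i ≠ j, and let s ∈ V satisfy ⟪s, pᵢ⟫ = 0 for all i and ⟪s, s⟫ = 1. Define α = -1/(n - k + 1), β = √(1 - k/(n(n - k + 1))), and p_{k+1} = α(p₁ + ⋯ + p_k) + β s. Then ⟪p_{k+1}, pᵢ⟫ = -1/n for all i = 1, …, k, and ⟪p_{k+1}, p_{k+1}⟫ = 1. -/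
open scoped RealInnerProductSpace

/-- Appendix B, inductive step: given `k` unit vectors with pairwise inner
products `-1/n` and a unit vector `s` orthogonal to all of them, the vector
`p_{k+1} = α ∑ pᵢ + β s` with `α = -1/(n - k + 1)` and
`β = √(1 - k/(n(n - k + 1)))` satisfies `⟪p_{k+1}, pᵢ⟫ = -1/n` and
`⟪p_{k+1}, p_{k+1}⟫ = 1`. -/
theorem stmt_4 (V : Type*) [NormedAddCommGroup V] [InnerProductSpace ℝ V]
    (n k : ℕ) (hn : 2 ≤ n) (hk1 : 1 ≤ k) (hk2 : k ≤ n - 1)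
    (p : Fin k → V)
    (hunit : ∀ i, ⟪p i, p i⟫ = 1)
    (hpair : ∀ i j, i ≠ j → ⟪p i, p j⟫ = -1 / (n : ℝ))
    (s : V) (horth : ∀ i, ⟪s, p i⟫ = 0) (hs : ⟪s, s⟫ = 1)
    (α β : ℝ) (hα : α = -1 / ((n : ℝ) - (k : ℝ) + 1))
    (hβ : β = Real.sqrt (1 - (k : ℝ) / ((n : ℝ) * ((n : ℝ) - (k : ℝ) + 1))))
    (q : V) (hq : q = α • (∑ i, p i) + β • s) :
    (∀ i, ⟪q, p i⟫ = -1 / (n : ℝ)) ∧ ⟪q, q⟫ = 1 := by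
  have hkn : (k : ℝ) + 1 ≤ n := by
    have : k + 1 ≤ n := by omega
    exact_mod_cast this
  have hn0 : (0 : ℝ) < n := by
    have : 0 < n := by omega
    exact_mod_cast this
  have hm : (1 : ℝ) ≤ (n : ℝ) - k + 1 := by linarith
  have hm0 : (n : ℝ) - k + 1 ≠ 0 := by linarith
  have hsum : ∀ i, ∑ j, ⟪p j, p i⟫ = ((n : ℝ) - k + 1) / n := by
    intro i
    have h : ∀ j, ⟪p j, p i⟫ = -1 / (n : ℝ) + if j = i then 1 + 1 / (n : ℝ) else 0 := by
      intro j
      by_cases hj : j = i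
      · subst hj
        rw [hunit, if_pos rfl]
        ring
      · rw [hpair j i hj, if_neg hj, add_zero]
    rw [Finset.sum_congr rfl (fun j _ => h j), Finset.sum_add_distrib]
    simp only [Finset.sum_const, Finset.card_univ, Fintype.card_fin, nsmul_eq_mul,
      Finset.sum_ite_eq', Finset.mem_univ, if_true]
    field_simp
    ring
  have hqp : ∀ i, ⟪q, p i⟫ = -1 / (n : ℝ) := by
    intro i
    rw [hq, inner_add_left, real_inner_smul_left, real_inner_smul_left, horth, sum_inner, hsum, hα]
    field_simp
    ring
  have hqs : ⟪q, s⟫ = β := by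
    rw [hq, inner_add_left, real_inner_smul_left, real_inner_smul_left, hs, sum_inner]
    have : ∀ i, ⟪p i, s⟫ = 0 := fun i => by rw [real_inner_comm]; exact horth i
    simp [this]
  have hβ2 : β * β = 1 - (k : ℝ) / ((n : ℝ) * ((n : ℝ) - (k : ℝ) + 1)) := by
    rw [hβ]
    apply Real.mul_self_sqrt
    rw [sub_nonneg, div_le_one (by positivity)]
    nlinarith
  refine ⟨hqp, ?_⟩
  have h1 : ⟪q, q⟫ = α * (k * (-1 / (n : ℝ))) + β * β := by
    conv_lhs => rw [hq]
    rw [← hq, ← hqs]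
    nth_rewrite 2 [hq]
    rw [inner_add_right, real_inner_smul_right, real_inner_smul_right, inner_sum,
      Finset.sum_congr rfl (fun i _ => hqp i), hqs]
    simp
  rw [h1, hβ2, hα]
  field_simp
  ring
end

section
/- Let N and m be positive natural numbers, let T₁, …, T_m be symmetric real N×N matrices, let D be a symmetric real N×N matrix, and let t, s : Fin m → ℝ satisfy Tr(Tᵢ D) ≤ tᵢ for all i and tᵢ ≤ ∑ⱼ Tr(Tᵢ Tⱼ) sⱼ for all i. Suppose moreover that every positive semidefinite real N×N matrix T can be written as T = ∑ᵢ λᵢ Tᵢ for some λ : Fin m → ℝ with λᵢ ≥ 0. Then the matrix (∑ⱼ sⱼ Tⱼ) - D is positive semidefinite. -/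
/-- Section III.A.2, conclusion: under the hypotheses of the trace
inequalities, if moreover every positive semidefinite matrix is a nonnegative
combination of the `Tᵢ`, then `∑ⱼ sⱼ Tⱼ - D` is positive semidefinite. -/
theorem stmt_11 (N m : ℕ) (hN : 0 < N) (hm : 0 < m)
    (T : Fin m → Matrix (Fin N) (Fin N) ℝ)
    (hTsymm : ∀ i, (T i).IsSymm)
    (D : Matrix (Fin N) (Fin N) ℝ) (hD : D.IsSymm)
    (t s : Fin m → ℝ)
    (ht : ∀ i, (T i * D).trace ≤ t i)
    (hts : ∀ i, t i ≤ ∑ j, (T i * T j).trace * s j)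
    (hgen : ∀ M : Matrix (Fin N) (Fin N) ℝ, M.PosSemidef →
      ∃ lam : Fin m → ℝ, (∀ i, 0 ≤ lam i) ∧ M = ∑ i, lam i • T i) :
    ((∑ j, s j • T j) - D).PosSemidef := by
  have key : ∀ i, 0 ≤ (T i * ((∑ j, s j • T j) - D)).trace := by
    intro i
    have h : (T i * ((∑ j, s j • T j) - D)).trace
        = ∑ j, (T i * T j).trace * s j - (T i * D).trace := by
      simp [Matrix.mul_sub, Matrix.mul_sum, Matrix.trace_sub, Matrix.trace_sum, mul_comm]
    rw [h]
    linarith [ht i, hts i]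
  have hsymm : ((∑ j, s j • T j) - D).IsHermitian := by
    unfold Matrix.IsHermitian
    rw [Matrix.conjTranspose_eq_transpose_of_trivial, Matrix.transpose_sub,
      Matrix.transpose_sum, hD.eq]
    simp [Matrix.transpose_smul, (hTsymm _).eq]
  generalize (∑ j, s j • T j) - D = A at key hsymm
  refine Matrix.PosSemidef.of_dotProduct_mulVec_nonneg hsymm fun x => ?_
  obtain ⟨lam, hlam, hM⟩ := hgen _ (Matrix.posSemidef_vecMulVec_self_star x)
  have h2 : star x ⬝ᵥ (A.mulVec x) = ((∑ i, lam i • T i) * A).trace := by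
    rw [← hM, Matrix.trace_mul_comm, Matrix.mul_vecMulVec, Matrix.trace_vecMulVec, dotProduct_comm]
  rw [h2, Matrix.sum_mul, Matrix.trace_sum]
  refine Finset.sum_nonneg fun i _ => ?_
  rw [Matrix.smul_mul, Matrix.trace_smul]
  exact mul_nonneg (hlam i) (key i)
end
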